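/- Let τ be a combinatorial type in 𝒞_q with des(τ) = d and sym(τ) = s, and let k > d be an integer with k ≥ 2. Then τ has exactly ((k−1)/s) · C(q+k−d−1, q−1) realizations under m_k. -/

import Mathlib

open scoped Classical

noncomputable section

/-- The representative of `i : ZMod q` in `{1, …, q}`. -/
def rep (q : ℕ) [NeZero q] (i : ZMod q) : ℕ :=
  if i = 0 then q else i.val

/-- The rotation `ρ : i ↦ i + 1 (mod q)` of `ZMod q`. -/
def rotPerm (q : ℕ) : Equiv.Perm (ZMod q) :=
  Equiv.addRight 1

/-- The descent number `des σ`: the number of `i ∈ ZMod q` with `σ(i) > σ(i+1)`,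
values compared via their representatives in `{1, …, q}`. -/
def desNum (q : ℕ) [NeZero q] (σ : Equiv.Perm (ZMod q)) : ℕ :=
  (Finset.univ.filter fun i : ZMod q => rep q (σ (i + 1)) < rep q (σ i)).card

/-- `σ` is a `q`-cycle, i.e. it acts transitively on `ZMod q`. -/
def IsQCycle (q : ℕ) (σ : Equiv.Perm (ZMod q)) : Prop :=
  ∀ i j : ZMod q, ∃ n : ℕ, (σ ^ n) i = j

/-- The transition matrix of `σ`: the `(i,j)` entry is `1` if `j` lies in the
cyclic interval `[σ(i), σ(i+1))` of `ZMod q` and `0` otherwise. -/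
def transMatrix (q : ℕ) [NeZero q] (σ : Equiv.Perm (ZMod q)) :
    Matrix (ZMod q) (ZMod q) ℝ :=
  Matrix.of fun i j => if (j - σ i).val < (σ (i + 1) - σ i).val then (1 : ℝ) else 0

/-- A probability vector: non-negative components summing to `1`. -/
def IsProbVec (q : ℕ) [NeZero q] (v : ZMod q → ℝ) : Prop :=
  (∀ i, 0 ≤ v i) ∧ ∑ i, v i = 1

/-- The symmetry order of `σ`: the order of the stabilizer of `σ` in the rotation
group `⟨ρ⟩` acting by conjugation. -/
def symOrder (q : ℕ) [NeZero q] (σ : Equiv.Perm (ZMod q)) : ℕ :=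
  ((Finset.range q).filter fun j => rotPerm q ^ j * σ * (rotPerm q ^ j)⁻¹ = σ).card

/-- `F : ℝ → ℝ` is a lift of a degree `k` covering map of `ℝ/ℤ`:
a homeomorphism of `ℝ` with `F (t+1) = F t + k`. -/
def IsDegreeLift (k : ℕ) (F : ℝ → ℝ) : Prop :=
  Continuous F ∧ StrictMono F ∧ ∀ t, F (t + 1) = F t + k

/-- The fixed point of the circle map corresponding to `u` (a point with
`F u - u ∈ ℤ`) is topologically repelling: `t ↦ F t - t` is strictly increasing
in a neighborhood of `u`. -/
def TopRepelling (F : ℝ → ℝ) (u : ℝ) : Prop :=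
  ∃ ε > 0, StrictMonoOn (fun t => F t - t) (Set.Ioo (u - ε) (u + ε))

/-- `x : ZMod q → ℝ` is a period `q` orbit realizing `σ` for the circle map with
lift `F`: the points `x i` lie in `(0,1)` and are increasing with respect to the
representatives `{1, …, q}` (so that `0, x₁, …, x_q` are in positive cyclic
order), and on the circle `f(x i) = x (σ i)` for all `i`. -/
def IsRealization (q : ℕ) [NeZero q] (σ : Equiv.Perm (ZMod q))
    (F : ℝ → ℝ) (x : ZMod q → ℝ) : Prop :=
  (∀ i, x i ∈ Set.Ioo (0 : ℝ) 1) ∧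
  (∀ i j : ZMod q, rep q i < rep q j → x i < x j) ∧
  (∀ i, ∃ m : ℤ, F (x i) = x (σ i) + m)

/-- A realization of `σ` under the multiplication map `m_k : x ↦ kx (mod ℤ)`. -/
def MkRealization (q k : ℕ) [NeZero q] (σ : Equiv.Perm (ZMod q)) (x : ZMod q → ℝ) : Prop :=
  IsRealization q σ (fun t => (k : ℝ) * t) x

/-- The upper endpoint (as a real number) of the partition interval
`I i = [x i, x (i+1)]`; for `i = 0 ≡ q` the interval wraps around `0 ∈ ℝ/ℤ`
and the endpoint is `x 1 + 1`. -/
def upperPt (q : ℕ) [NeZero q] (x : ZMod q → ℝ) (i : ZMod q) : ℝ :=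
  if i = 0 then x 1 + 1 else x (i + 1)

/-- The `i`-th component of the fixed point distribution: the number of fixed
points of `m_k` (the points `j/(k-1) (mod ℤ)`) in the interior of the partition
interval `I i`. -/
def fixDist (q k : ℕ) [NeZero q] (x : ZMod q → ℝ) (i : ZMod q) : ℕ :=
  ((Finset.Icc 1 (2 * (k - 1))).filter fun j : ℕ =>
    x i < (j : ℝ) / ((k : ℝ) - 1) ∧ (j : ℝ) / ((k : ℝ) - 1) < upperPt q x i).card

/-- The number of fixed points of `m_k` in the interval `(0, x 1)`. -/
def countFixBelow (q k : ℕ) [NeZero q] (x : ZMod q → ℝ) : ℕ :=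
  ((Finset.range (k - 1)).filter fun j : ℕ =>
    0 < j ∧ (j : ℝ) / ((k : ℝ) - 1) < x 1).card

/-- The `m`-th component of the (cumulative) deployment vector: the number of
orbit points in `(0, m/(k-1))`. -/
def depCount (q k : ℕ) [NeZero q] (x : ZMod q → ℝ) (m : ℕ) : ℕ :=
  (Finset.univ.filter fun j : ZMod q => x j < (m : ℝ) / ((k : ℝ) - 1)).card

/-- The rank of a marked index `i` among the marked indices `i₁ < ⋯ < i_{d-1}`
(ordered by their representatives in `{1, …, q}`). -/
def markRank (q : ℕ) [NeZero q] (σ : Equiv.Perm (ZMod q)) (i : ZMod q) : ℕ :=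
  (Finset.univ.filter fun i' : ZMod q =>
    transMatrix q σ i' i' = 1 ∧ rep q i' ≤ rep q i).card

open Finset in
lemma strict_count (a N : ℕ) :
    {y : Fin a → ℤ | StrictMono y ∧ ∀ i, 0 ≤ y i ∧ y i < N}.ncard = N.choose a := by
  have h : {y : Fin a → ℤ | StrictMono y ∧ ∀ i, 0 ≤ y i ∧ y i < N}
      = Set.range (fun (f : Fin a ↪o Fin N) (i : Fin a) => ((f i : ℕ) : ℤ)) := by
    ext y
    constructor
    · rintro ⟨h1, h2⟩
      have hb : ∀ i, (y i).toNat < N := fun i => by have := h2 i; omega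
      refine ⟨OrderEmbedding.ofStrictMono (fun i => ⟨(y i).toNat, hb i⟩) ?_, ?_⟩
      · intro i j hij
        have := h1 hij
        have := h2 i
        have := h2 j
        simp only [Fin.mk_lt_mk]
        omega
      · funext i
        have := h2 i
        change (((y i).toNat : ℕ) : ℤ) = y i
        omega
    · rintro ⟨f, rfl⟩
      refine ⟨fun i j hij => ?_, fun i => ?_⟩
      · have := f.strictMono hij
        simp only [Fin.lt_def] at this
        simpa using this
      · simp
  rw [h, ← Set.image_univ, Set.ncard_image_of_injective]
  · rw [Set.ncard_univ, Nat.card_congr Set.powersetCard.ofFinEmbEquiv, Set.powersetCard.card]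
    simp
  · intro f g hfg
    ext i
    have := congrFun hfg i
    simpa using this

/-- number of linear ascents before `i` -/
def ascB {n : ℕ} (π : Equiv.Perm (Fin (n + 1))) (i : Fin (n + 1)) : ℕ :=
  (Finset.univ.filter fun l : Fin n => l.castSucc < i ∧ π l.castSucc < π l.succ).card

lemma ascB_zero {n : ℕ} (π : Equiv.Perm (Fin (n + 1))) : ascB π 0 = 0 := by
  simp [ascB]

lemma ascB_succ {n : ℕ} (π : Equiv.Perm (Fin (n + 1))) (l : Fin n) :
    ascB π l.succ = ascB π l.castSucc + if π l.castSucc < π l.succ then 1 else 0 := by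
  unfold ascB
  have : (Finset.univ.filter fun l' : Fin n => l'.castSucc < l.succ ∧ π l'.castSucc < π l'.succ)
     = (Finset.univ.filter fun l' : Fin n => l'.castSucc < l.castSucc ∧ π l'.castSucc < π l'.succ)
      ∪ (if π l.castSucc < π l.succ then {l} else ∅) := by
    ext l'
    have h1 : l'.castSucc < l.succ ↔ (l'.castSucc < l.castSucc ∨ l' = l) := by
      simp only [Fin.lt_def, Fin.ext_iff, Fin.val_castSucc, Fin.val_succ]
      omega
    split_ifs with h
    · simp only [Finset.mem_filter, Finset.mem_univ, true_and, Finset.mem_union,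
        Finset.mem_singleton, h1]
      constructor
      · tauto
      · rintro (h2 | rfl)
        · tauto
        · tauto
    · simp only [Finset.mem_filter, Finset.mem_univ, true_and, Finset.mem_union, h1]
      constructor
      · rintro ⟨h2 | rfl, h3⟩
        · tauto
        · tauto
      · simp
        tauto
  rw [this, Finset.card_union_of_disjoint]
  · split_ifs <;> simp
  · split_ifs <;> simp

lemma ascB_last {n : ℕ} (π : Equiv.Perm (Fin (n + 1))) :
    ascB π (Fin.last n) +
      (Finset.univ.filter fun l : Fin n => π l.succ < π l.castSucc).card = n := by
  have h := Finset.card_filter_add_card_filter_not (s := (Finset.univ : Finset (Fin n)))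
    (fun l : Fin n => π l.castSucc < π l.succ)
  simp only [Finset.card_univ, Fintype.card_fin] at h
  refine Eq.trans ?_ h
  unfold ascB
  congr 2
  · ext l
    simp [Fin.castSucc_lt_last]
  · ext l
    have : π l.castSucc ≠ π l.succ := by
      intro h
      have := π.injective h
      simp [Fin.ext_iff] at this
    simp only [Finset.mem_filter, Finset.mem_univ, true_and, not_lt]
    exact ⟨le_of_lt, fun h => lt_of_le_of_ne h this.symm⟩

lemma digit_count (n k : ℕ) (π : Equiv.Perm (Fin (n + 1)))
    (hD : (Finset.univ.filter fun l : Fin n => π l.succ < π l.castSucc).card < k) :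
    {m : Fin (n + 1) → ℤ | (∀ i, 0 ≤ m i ∧ m i < k) ∧
      StrictMono (fun i => toLex (m i, π i))}.ncard =
    (k + n - (Finset.univ.filter fun l : Fin n => π l.succ < π l.castSucc).card).choose (n + 1) := by
  rw [← strict_count]
  set D := (Finset.univ.filter fun l : Fin n => π l.succ < π l.castSucc).card with hDdef
  have hl := ascB_last π
  rw [← hDdef] at hl
  have key : ∀ m : Fin (n + 1) → ℤ, StrictMono (fun i => toLex (m i, π i)) ↔
      StrictMono (fun i => m i + ascB π i) := by
    intro m
    rw [Fin.strictMono_iff_lt_succ, Fin.strictMono_iff_lt_succ]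
    refine forall_congr' fun l => ?_
    rw [ascB_succ, Prod.Lex.toLex_lt_toLex]
    dsimp only
    split_ifs with h
    · simp only [h, and_true]; push_cast; omega
    · simp only [h, and_false, or_false]; push_cast; omega
  have ascmono : Monotone (ascB π) := by
    rw [Fin.monotone_iff_le_succ]
    intro l
    rw [ascB_succ]; omega
  have hmono : ∀ m : Fin (n + 1) → ℤ, StrictMono (fun i => toLex (m i, π i)) → Monotone m := by
    intro m hm
    rw [Fin.monotone_iff_le_succ]
    intro l
    have := (Fin.strictMono_iff_lt_succ.1 hm) l
    rw [Prod.Lex.toLex_lt_toLex] at this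
    dsimp only at this
    omega
  refine Set.ncard_congr (fun m _ => fun i => m i + ascB π i) ?_ ?_ ?_
  · rintro m ⟨h1, h2⟩
    refine ⟨(key m).1 h2, fun i => ?_⟩
    have := h1 i
    have := ascmono (Fin.le_last i)
    dsimp only
    omega
  · intro a b _ _ h
    funext i
    have := congrFun h i
    simpa using this
  · rintro y ⟨h1, h2⟩
    have e : (fun i => (y i - ascB π i) + (ascB π i : ℤ)) = y := by funext i; ring
    have h3 : StrictMono (fun i => toLex (y i - ascB π i, π i)) := by
      rw [key, e]; exact h1
    refine ⟨fun i => y i - ascB π i, ⟨fun i => ?_, h3⟩, e⟩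
    have hm := hmono _ h3
    have a1 := hm (Fin.zero_le i)
    have a2 := hm (Fin.le_last i)
    have a3 := h2 0
    have a4 := h2 (Fin.last n)
    have a5 := ascB_zero π
    dsimp only at a1 a2 ⊢
    omega

lemma realize_count (n k : ℕ) (hn : 1 ≤ n) (hk : 2 ≤ k) (π : Equiv.Perm (Fin (n + 1)))
    (hπ : ∀ i j, ∃ t : ℕ, (π ^ t) i = j) :
    {X : Fin (n + 1) → ℝ | (∀ i, X i ∈ Set.Ioo (0 : ℝ) 1) ∧ StrictMono X ∧
      ∀ i, ∃ m : ℤ, (k : ℝ) * X i = X (π i) + m}.ncard =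
    {m : Fin (n + 1) → ℤ | (∀ i, 0 ≤ m i ∧ m i < k) ∧
      StrictMono (fun i => toLex (m i, π i))}.ncard := by
  have hk' : (2 : ℝ) ≤ k := by exact_mod_cast hk
  -- the linear operator
  let L : (Fin (n + 1) → ℝ) →ₗ[ℝ] (Fin (n + 1) → ℝ) :=
    { toFun := fun x i => (k : ℝ) * x i - x (π i)
      map_add' := by intro x y; funext i; simp; ring
      map_smul' := by intro c x; funext i; simp; ring }
  have hL : ∀ x i, L x i = (k : ℝ) * x i - x (π i) := fun _ _ => rfl
  have hinj : Function.Injective L := by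
    rw [← LinearMap.ker_eq_bot, LinearMap.ker_eq_bot']
    intro x hx
    obtain ⟨i, hi⟩ := Finite.exists_max (fun i => |x i|)
    have h1 : (k : ℝ) * x i = x (π i) := by
      have := congrFun hx i
      rw [hL] at this
      simp only [Pi.zero_apply] at this
      linarith
    have h2 : (k : ℝ) * |x i| ≤ |x i| := by
      calc (k : ℝ) * |x i| = |x (π i)| := by rw [← h1, abs_mul, Nat.abs_cast]
        _ ≤ _ := hi _
    have h3 : |x i| ≤ 0 := by nlinarith [abs_nonneg (x i)]
    funext j
    have := (hi j).trans h3
    simpa using this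
  have hsurj : Function.Surjective L := LinearMap.injective_iff_surjective.1 hinj
  have hfix : ∀ (P : Fin (n + 1) → Prop), (∀ i, P i → P (π i)) → ∀ i, P i → ∀ j, P j := by
    intro P hP i hi j
    obtain ⟨t, rfl⟩ := hπ i j
    clear hsurj hinj
    induction t with
    | zero => simpa using hi
    | succ t ih => rw [pow_succ', Equiv.Perm.mul_apply]; exact hP _ ih
  have hnomono : ¬ StrictMono π := by
    intro h
    have h1 : π (Fin.last n) = Fin.last n := le_antisymm (Fin.le_last _) (h.le_apply)
    have := hfix (fun i => i = Fin.last n) (fun i hi => by rw [hi, h1]) _ rfl 0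
    simp [Fin.ext_iff] at this
    omega
  symm
  refine Set.ncard_congr (fun m _ => (hsurj (fun i => (m i : ℝ))).choose) ?_ ?_ ?_
  · rintro m ⟨h1, h2⟩
    have hx := (hsurj (fun i => (m i : ℝ))).choose_spec
    set x := (hsurj (fun i => (m i : ℝ))).choose
    have hx' : ∀ i, (k : ℝ) * x i = x (π i) + m i := by
      intro i
      have := congrFun hx i
      rw [hL] at this
      linarith
    have hm0 : ∀ i, (0 : ℝ) ≤ m i := fun i => by exact_mod_cast (h1 i).1
    have hmk : ∀ i, (m i : ℝ) ≤ k - 1 := fun i => by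
      have := (h1 i).2
      have h : m i ≤ (k : ℤ) - 1 := by omega
      exact_mod_cast h
    have hconst : ∀ c, ¬ ∀ i, m i = c := by
      intro c hc
      apply hnomono
      intro i j hij
      have := h2 hij
      rw [Prod.Lex.toLex_lt_toLex] at this
      simpa [hc] using this
    have hx0 : ∀ i, 0 ≤ x i := by
      obtain ⟨i, hi⟩ := Finite.exists_min x
      intro j
      refine le_trans ?_ (hi j)
      have := hi (π i)
      have := hx' i
      have := hm0 i
      nlinarith
    have hx1 : ∀ i, x i ≤ 1 := by
      obtain ⟨i, hi⟩ := Finite.exists_max x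
      intro j
      refine le_trans (hi j) ?_
      have := hi (π i)
      have := hx' i
      have := hmk i
      nlinarith
    have hx0' : ∀ i, x i ≠ 0 := by
      intro i hi
      have h := hfix (fun i => x i = 0) (fun i hi => by
        have := hx' i
        have := hm0 i
        have := hx0 (π i)
        rw [hi] at *
        linarith) i hi
      apply hconst 0
      intro j
      have h3 := hx' j
      rw [h j, h (π j)] at h3
      have : (m j : ℝ) = 0 := by linarith
      exact_mod_cast this
    have hx1' : ∀ i, x i ≠ 1 := by
      intro i hi
      have h := hfix (fun i => x i = 1) (fun i hi => by
        have := hx' i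
        have := hmk i
        have := hx1 (π i)
        rw [hi] at *
        linarith) i hi
      apply hconst (k - 1)
      intro j
      have h3 := hx' j
      rw [h j, h (π j)] at h3
      have : (m j : ℝ) = k - 1 := by linarith
      exact_mod_cast this
    have hlo : ∀ i, 0 < x i := fun i => lt_of_le_of_ne (hx0 i) (hx0' i).symm
    have hhi : ∀ i, x i < 1 := fun i => lt_of_le_of_ne (hx1 i) (hx1' i)
    refine ⟨fun i => ⟨hlo i, hhi i⟩, ?_, fun i => ⟨m i, hx' i⟩⟩
    intro i j hij
    by_contra hcon
    push Not at hcon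
    have step : ∀ i j, i < j → x j ≤ x i → π i < π j ∧ x (π j) ≤ x (π i) := by
      intro i j hij hle
      have h3 := h2 hij
      rw [Prod.Lex.toLex_lt_toLex] at h3
      have a1 := hx' i
      have a2 := hx' j
      have a3 : (k : ℝ) * x j ≤ k * x i := by nlinarith
      rcases h3 with h3 | ⟨h3, h4⟩
      · exfalso
        dsimp only at h3
        have h5 : (m i : ℝ) + 1 ≤ m j := by exact_mod_cast h3
        have := hlo (π j)
        have := hhi (π i)
        linarith
      · dsimp only at h3 h4
        refine ⟨h4, ?_⟩
        have h5 : (m i : ℝ) = m j := by exact_mod_cast h3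
        linarith
    have iter : ∀ t : ℕ, (π ^ t) i < (π ^ t) j ∧ x ((π ^ t) j) ≤ x ((π ^ t) i) := by
      intro t
      induction t with
      | zero => exact ⟨hij, hcon⟩
      | succ t ih =>
        rw [pow_succ', Equiv.Perm.mul_apply, Equiv.Perm.mul_apply]
        exact step _ _ ih.1 ih.2
    obtain ⟨t, ht⟩ := hπ i (Fin.last n)
    have := (iter t).1
    rw [ht] at this
    exact absurd this (Fin.le_last _).not_gt
  · intro a b _ _ hab
    have ha := (hsurj (fun i => (a i : ℝ))).choose_spec
    have hb := (hsurj (fun i => (b i : ℝ))).choose_spec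
    rw [hab, hb] at ha
    funext i
    have := congrFun ha i
    exact_mod_cast this.symm
  · rintro X ⟨h1, h2, h3⟩
    choose m hm using h3
    have hmem : m ∈ {m : Fin (n + 1) → ℤ | (∀ i, 0 ≤ m i ∧ m i < k) ∧
      StrictMono (fun i => toLex (m i, π i))} := by
      refine ⟨fun i => ?_, fun i j hij => ?_⟩
      · have a1 := h1 i
        have a2 := h1 (π i)
        have a3 := hm i
        have a4 : (-1 : ℝ) < m i := by nlinarith [a1.1, a2.2]
        have a5 : (m i : ℝ) < k := by nlinarith [a1.2, a2.1]
        have a6 : -1 < m i := by exact_mod_cast a4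
        have a7 : m i < k := by exact_mod_cast a5
        omega
      · rw [Prod.Lex.toLex_lt_toLex]
        dsimp only
        have a0 := h2 hij
        have a1 := h1 (π i)
        have a2 := h1 (π j)
        have a3 := hm i
        have a4 := hm j
        have a5 : (k : ℝ) * X i < k * X j := by nlinarith
        by_cases hlt : m i < m j
        · exact Or.inl hlt
        · right
          push Not at hlt
          have b1 : (m j : ℝ) ≤ m i := by exact_mod_cast hlt
          have b2 : (m i : ℝ) < m j + 1 := by linarith [a1.1, a2.2]
          have b3 : m i < m j + 1 := by exact_mod_cast b2
          refine ⟨by omega, ?_⟩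
          rw [← h2.lt_iff_lt]
          linarith
    refine ⟨m, hmem, ?_⟩
    apply hinj
    have := (hsurj (fun i => (m i : ℝ))).choose_spec
    rw [this]
    funext i
    rw [hL, hm i]
    ring

lemma rep_pos (q : ℕ) [NeZero q] (a : ZMod q) : 1 ≤ rep q a := by
  unfold rep
  split_ifs with h
  · exact NeZero.one_le
  · have : a.val ≠ 0 := by rwa [Ne, ZMod.val_eq_zero]
    omega

lemma rep_le (q : ℕ) [NeZero q] (a : ZMod q) : rep q a ≤ q := by
  unfold rep
  split_ifs with h
  · exact le_rfl
  · exact (ZMod.val_lt a).le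

lemma rep_cast (q : ℕ) [NeZero q] (a : ZMod q) : ((rep q a : ℕ) : ZMod q) = a := by
  unfold rep
  split_ifs with h
  · simp [h]
  · simp

lemma rep_inj (q : ℕ) [NeZero q] {a b : ZMod q} (h : rep q a = rep q b) : a = b := by
  rw [← rep_cast q a, h, rep_cast]

lemma rep_unique (q : ℕ) [NeZero q] (a : ZMod q) (r : ℕ) (h1 : 1 ≤ r) (h2 : r ≤ q)
    (h : (r : ZMod q) = a) : rep q a = r := by
  have h3 : ((rep q a : ℕ) : ZMod q) = (r : ZMod q) := by rw [rep_cast, h]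
  rw [ZMod.natCast_eq_natCast_iff] at h3
  have h4 := rep_pos q a
  have h5 := rep_le q a
  have h6 := h3.dvd
  obtain ⟨c, hc⟩ := h6
  have hq : 1 ≤ q := NeZero.one_le
  have : c = 0 := by
    by_contra hne
    rcases lt_or_gt_of_ne hne with h | h
    · have : c ≤ -1 := by omega
      nlinarith
    · have : 1 ≤ c := by omega
      nlinarith
  rw [this] at hc
  omega

lemma rep_diff (q : ℕ) [NeZero q] (a b : ZMod q) :
    (rep q b : ℤ) - rep q a = (b - a).val - q * (if rep q b < rep q a then 1 else 0) := by
  have ha := rep_pos q a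
  have ha' := rep_le q a
  have hb := rep_pos q b
  have hb' := rep_le q b
  have hv := ZMod.val_lt (b - a)
  have h : (((rep q b : ℤ) - rep q a : ℤ) : ZMod q) = (((b - a).val : ℤ) : ZMod q) := by
    push_cast
    rw [rep_cast, rep_cast, ZMod.natCast_zmod_val]
  rw [ZMod.intCast_eq_intCast_iff] at h
  obtain ⟨c, hc⟩ := h.dvd
  have hq : 1 ≤ q := NeZero.one_le
  have c1 : c ≤ 1 := by
    by_contra hne
    have : 2 ≤ c := by omega
    nlinarith
  have c0 : 0 ≤ c := by
    by_contra hne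
    have : c ≤ -1 := by omega
    nlinarith
  have : c = 0 ∨ c = 1 := by omega
  rcases this with rfl | rfl
  · split_ifs <;> omega
  · split_ifs <;> omega

lemma sum_delta (q : ℕ) [NeZero q] (σ : Equiv.Perm (ZMod q)) :
    ∑ i, ((σ (i + 1) - σ i).val : ℤ) = q * desNum q σ := by
  have h : ∑ i, ((rep q (σ (i + 1)) : ℤ) - rep q (σ i)) = 0 := by
    rw [Finset.sum_sub_distrib, sub_eq_zero]
    exact Equiv.sum_comp (Equiv.addRight (1 : ZMod q)) (fun i => (rep q (σ i) : ℤ))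
  simp_rw [rep_diff] at h
  rw [Finset.sum_sub_distrib, ← Finset.mul_sum] at h
  unfold desNum
  rw [Finset.card_filter]
  push_cast
  linarith

/-- conjugate of `σ` by the rotation by `c` -/
def rc (q : ℕ) (σ : Equiv.Perm (ZMod q)) (c : ZMod q) : Equiv.Perm (ZMod q) :=
  Equiv.addRight c * σ * (Equiv.addRight c)⁻¹

lemma rc_apply (q : ℕ) (σ : Equiv.Perm (ZMod q)) (c i : ZMod q) :
    rc q σ c i = σ (i - c) + c := by
  unfold rc
  have : (Equiv.addRight c)⁻¹ i = i - c := by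
    rw [Equiv.Perm.inv_eq_iff_eq]; simp
  simp only [Equiv.Perm.mul_apply, this]
  simp

lemma rotPerm_pow (q j : ℕ) : rotPerm q ^ j = Equiv.addRight ((j : ℕ) : ZMod q) := by
  induction j with
  | zero => ext i; simp
  | succ j ih =>
    rw [pow_succ, ih]
    apply Equiv.ext
    intro i
    simp only [rotPerm, Equiv.Perm.mul_apply, Equiv.coe_addRight]
    push_cast
    ring

lemma conj_eq (q j : ℕ) (σ : Equiv.Perm (ZMod q)) :
    rotPerm q ^ j * σ * (rotPerm q ^ j)⁻¹ = rc q σ j := by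
  rw [rotPerm_pow]; rfl

lemma rc_add (q : ℕ) (σ : Equiv.Perm (ZMod q)) (a b : ZMod q) :
    rc q (rc q σ a) b = rc q σ (a + b) := by
  apply Equiv.ext
  intro i
  simp only [rc_apply]
  rw [show i - b - a = i - (a + b) by ring]
  ring

lemma rc_zero (q : ℕ) (σ : Equiv.Perm (ZMod q)) : rc q σ 0 = σ := by
  ext i
  simp [rc_apply]

lemma des_rc (q : ℕ) [NeZero q] (σ : Equiv.Perm (ZMod q)) (c : ZMod q) :
    desNum q (rc q σ c) = desNum q σ := by
  have h1 := sum_delta q (rc q σ c)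
  have h2 := sum_delta q σ
  have h3 : ∑ i, ((rc q σ c (i + 1) - rc q σ c i).val : ℤ) = ∑ i, ((σ (i + 1) - σ i).val : ℤ) := by
    rw [← Equiv.sum_comp (Equiv.subRight c) (fun i => ((σ (i + 1) - σ i).val : ℤ))]
    refine Finset.sum_congr rfl fun i _ => ?_
    simp only [rc_apply, Equiv.subRight_apply]
    rw [add_sub_add_right_eq_sub, show i + 1 - c = i - c + 1 by ring]
  rw [h3, h2] at h1
  have hq : (q : ℤ) ≠ 0 := by exact_mod_cast NeZero.ne q
  have := mul_left_cancel₀ hq h1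
  exact_mod_cast this.symm

lemma cyc_rc (q : ℕ) (σ : Equiv.Perm (ZMod q)) (hσ : IsQCycle q σ) (c : ZMod q) :
    IsQCycle q (rc q σ c) := by
  intro i j
  obtain ⟨t, ht⟩ := hσ (i - c) (j - c)
  refine ⟨t, ?_⟩
  have : ∀ t : ℕ, (rc q σ c ^ t) i = (σ ^ t) (i - c) + c := by
    intro t
    induction t with
    | zero => simp
    | succ t ih =>
      rw [pow_succ', Equiv.Perm.mul_apply, ih, pow_succ', Equiv.Perm.mul_apply, rc_apply]
      simp
  rw [this, ht]; ring

lemma cyc_nofix (q : ℕ) (hq : 2 ≤ q) (σ : Equiv.Perm (ZMod q)) (hσ : IsQCycle q σ) (i : ZMod q) :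
    σ i ≠ i := by
  intro h
  have hall : ∀ t : ℕ, (σ ^ t) i = i := by
    intro t
    induction t with
    | zero => simp
    | succ t ih => rw [pow_succ', Equiv.Perm.mul_apply, ih, h]
  obtain ⟨t, ht⟩ := hσ i (i + 1)
  rw [hall] at ht
  have : Fact (1 < q) := ⟨by omega⟩
  simp at ht

lemma rep_add_one (q : ℕ) [NeZero q] (a : ZMod q) (ha : a ≠ 0) : rep q (a + 1) = rep q a + 1 := by
  have h1 := rep_pos q a
  have h2 := rep_le q a
  have h3 : rep q a ≠ q := by
    intro h
    apply ha
    rw [← rep_cast q a, h]; simp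
  apply rep_unique
  · omega
  · omega
  · push_cast; rw [rep_cast]

lemma marked_count (q : ℕ) [NeZero q] (hq : 2 ≤ q) (σ : Equiv.Perm (ZMod q)) (hσ : IsQCycle q σ) :
    (Finset.univ.filter fun c : ZMod q => rep q (rc q σ c 1) < rep q (rc q σ c 0)).card + 1
      = desNum q σ := by
  have h1 : ∑ c, ((rep q (rc q σ c 1) : ℤ) - rep q (rc q σ c 0)) = q := by
    have e : ∀ c, (rep q (rc q σ c 1) : ℤ) = rep q (rc q σ (c - 1) 0) + 1 := by
      intro c
      have : rc q σ c 1 = rc q σ (c - 1) 0 + 1 := by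
        simp only [rc_apply]
        rw [show (0 : ZMod q) - (c - 1) = 1 - c by ring]; ring
      rw [this, rep_add_one]
      · push_cast; rfl
      · exact cyc_nofix q hq _ (cyc_rc q σ hσ _) 0
    simp_rw [e]
    have hs : ∑ c, (rep q (rc q σ (c - 1) 0) : ℤ) = ∑ c, (rep q (rc q σ c 0) : ℤ) :=
      Equiv.sum_comp (Equiv.subRight (1 : ZMod q)) (fun c => (rep q (rc q σ c 0) : ℤ))
    rw [Finset.sum_sub_distrib, Finset.sum_add_distrib, hs]
    simp [ZMod.card]
  simp_rw [rep_diff] at h1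
  rw [Finset.sum_sub_distrib, ← Finset.mul_sum] at h1
  have h3 : ∑ c, ((rc q σ c 1 - rc q σ c 0).val : ℤ) = ∑ i, ((σ (i + 1) - σ i).val : ℤ) := by
    rw [← Equiv.sum_comp (Equiv.neg (ZMod q)) (fun i => ((σ (i + 1) - σ i).val : ℤ))]
    refine Finset.sum_congr rfl fun i _ => ?_
    simp only [rc_apply, Equiv.neg_apply]
    rw [add_sub_add_right_eq_sub, show 1 - i = -i + 1 by ring, zero_sub]
  rw [h3, sum_delta] at h1
  rw [Finset.card_filter]
  have hq0 : (q : ℤ) ≠ 0 := by exact_mod_cast NeZero.ne q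
  have h4 : (q : ℤ) * ((∑ c, (if rep q (rc q σ c 1) < rep q (rc q σ c 0) then (1 : ℤ) else 0)) + 1)
     = q * desNum q σ := by linarith
  have h5 := mul_left_cancel₀ hq0 h4
  have h6 : (((∑ c, (if rep q (rc q σ c 1) < rep q (rc q σ c 0) then 1 else 0)) + 1 : ℕ) : ℤ)
     = desNum q σ := by
    rw [← h5]
    push_cast
    rfl
  exact_mod_cast h6

lemma fin_equiv (n : ℕ) : ∃ e : Fin (n + 1) ≃ ZMod (n + 1),
    (∀ i, rep (n + 1) (e i) = i.val + 1) ∧ (∀ i, e i = ((i.val + 1 : ℕ) : ZMod (n + 1))) := by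
  have hr : ∀ i : Fin (n + 1), rep (n + 1) ((i.val + 1 : ℕ) : ZMod (n + 1)) = i.val + 1 := by
    intro i
    apply rep_unique
    · omega
    · omega
    · rfl
  have hb : Function.Bijective (fun i : Fin (n + 1) => ((i.val + 1 : ℕ) : ZMod (n + 1))) := by
    rw [Fintype.bijective_iff_injective_and_card]
    constructor
    · intro i j hij
      have h := congrArg (rep (n + 1)) hij
      simp only [hr] at h
      ext; omega
    · simp [ZMod.card]
  exact ⟨Equiv.ofBijective _ hb, hr, fun i => rfl⟩

lemma mk_count (n k : ℕ) (hn : 1 ≤ n) (hk : 2 ≤ k) (σ : Equiv.Perm (ZMod (n + 1)))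
    (hσ : IsQCycle (n + 1) σ) (hd : desNum (n + 1) σ < k) :
    {x | MkRealization (n + 1) k σ x}.ncard =
      (k + n - desNum (n + 1) σ +
        if rep (n + 1) (σ 1) < rep (n + 1) (σ 0) then 1 else 0).choose (n + 1) := by
  obtain ⟨e, he, he'⟩ := fin_equiv n
  let π : Equiv.Perm (Fin (n + 1)) := (e.trans σ).trans e.symm
  have hπ : ∀ i, e (π i) = σ (e i) := fun i => by simp [π]
  have hpow : ∀ (t : ℕ) i, e ((π ^ t) i) = (σ ^ t) (e i) := by
    intro t i
    induction t with
    | zero => simp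
    | succ t ih => rw [pow_succ', pow_succ', Equiv.Perm.mul_apply, Equiv.Perm.mul_apply, hπ, ih]
  have hcyc : ∀ i j, ∃ t : ℕ, (π ^ t) i = j := by
    intro i j
    obtain ⟨t, ht⟩ := hσ (e i) (e j)
    exact ⟨t, e.injective (by rw [hpow, ht])⟩
  have hlt : ∀ a b, a < b ↔ rep (n + 1) (e a) < rep (n + 1) (e b) := by
    intro a b
    rw [he, he, Fin.lt_def]; omega
  have hD : desNum (n + 1) σ =
      (Finset.univ.filter fun l : Fin n => π l.succ < π l.castSucc).card +
        if rep (n + 1) (σ 1) < rep (n + 1) (σ 0) then 1 else 0 := by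
    unfold desNum
    rw [Finset.card_filter, Finset.card_filter, ← Equiv.sum_comp e, Fin.sum_univ_castSucc]
    have hlast : e (Fin.last n) = 0 := by
      rw [he', Fin.val_last]; exact ZMod.natCast_self _
    rw [hlast, zero_add]
    congr 1
    refine Finset.sum_congr rfl fun l _ => ?_
    have hs : e l.castSucc + 1 = e l.succ := by
      rw [he', he']; simp
    rw [hs]
    simp only [hlt, hπ]
  have hcount := realize_count n k hn hk π hcyc
  rw [digit_count n k π (by omega)] at hcount
  have hE : k + n - (Finset.univ.filter fun l : Fin n => π l.succ < π l.castSucc).card =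
     k + n - desNum (n + 1) σ + if rep (n + 1) (σ 1) < rep (n + 1) (σ 0) then 1 else 0 := by
    rw [hD] at hd ⊢
    split_ifs at hd ⊢ <;> omega
  rw [hE] at hcount
  rw [← hcount]
  refine Set.ncard_congr (fun x _ => x ∘ e) ?_ ?_ ?_
  · rintro x ⟨h1, h2, h3⟩
    refine ⟨fun i => h1 _, fun i j hij => h2 _ _ ((hlt i j).1 hij), fun i => ?_⟩
    obtain ⟨m, hm⟩ := h3 (e i)
    refine ⟨m, ?_⟩
    simp only [Function.comp_apply, hπ]
    exact hm
  · intro a b _ _ hab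
    exact e.surjective.injective_comp_right hab
  · rintro X ⟨h1, h2, h3⟩
    refine ⟨X ∘ e.symm, ⟨fun i => h1 _, fun i j hij => ?_, fun i => ?_⟩, ?_⟩
    · apply h2
      rw [hlt]; simpa using hij
    · obtain ⟨m, hm⟩ := h3 (e.symm i)
      refine ⟨m, ?_⟩
      simp only [Function.comp_apply]
      rw [hm]
      simp [π]
    · funext i; simp

lemma mk_unique (q k : ℕ) [NeZero q] (σ τ : Equiv.Perm (ZMod q)) (x : ZMod q → ℝ)
    (h1 : MkRealization q k σ x) (h2 : MkRealization q k τ x) : σ = τ := by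
  have hinj : Function.Injective x := by
    intro i j hij
    by_contra hne
    have : rep q i ≠ rep q j := fun h => hne (rep_inj q h)
    rcases lt_or_gt_of_ne this with h | h
    · exact (h1.2.1 _ _ h).ne hij
    · exact (h1.2.1 _ _ h).ne hij.symm
  apply Equiv.ext
  intro i
  apply hinj
  obtain ⟨m, hm⟩ := h1.2.2 i
  obtain ⟨m', hm'⟩ := h2.2.2 i
  have a := h1.1 (σ i)
  have b := h1.1 (τ i)
  rw [hm] at hm'
  have c1 : (m : ℝ) < m' + 1 := by linarith [a.1, b.2]
  have c2 : (m' : ℝ) < m + 1 := by linarith [a.2, b.1]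
  have c3 : m < m' + 1 := by exact_mod_cast c1
  have c4 : m' < m + 1 := by exact_mod_cast c2
  have : m = m' := by omega
  rw [this] at hm'
  linarith

lemma sym_eq (q : ℕ) [NeZero q] (σ : Equiv.Perm (ZMod q)) :
    symOrder q σ = (Finset.univ.filter fun c : ZMod q => rc q σ c = σ).card := by
  unfold symOrder
  simp_rw [conj_eq]
  refine Finset.card_bij (fun j _ => (j : ZMod q)) ?_ ?_ ?_
  · intro j hj
    simpa using (Finset.mem_filter.1 hj).2
  · intro a ha b hb hab
    have h1 := Finset.mem_range.1 (Finset.mem_filter.1 ha).1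
    have h2 := Finset.mem_range.1 (Finset.mem_filter.1 hb).1
    have := congrArg ZMod.val hab
    rwa [ZMod.val_natCast_of_lt h1, ZMod.val_natCast_of_lt h2] at this
  · intro c hc
    refine ⟨c.val, ?_, by simp⟩
    simp only [Finset.mem_filter, Finset.mem_range, ZMod.natCast_zmod_val]
    exact ⟨ZMod.val_lt c, (Finset.mem_filter.1 hc).2⟩

lemma fiber_card (q : ℕ) [NeZero q] (σ : Equiv.Perm (ZMod q)) (c₀ : ZMod q) :
    (Finset.univ.filter fun c : ZMod q => rc q σ c = rc q σ c₀).card = symOrder q σ := by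
  rw [sym_eq]
  refine Finset.card_equiv (Equiv.subRight c₀) fun c => ?_
  simp only [Finset.mem_filter, Finset.mem_univ, true_and, Equiv.subRight_apply]
  constructor
  · intro h
    have := congrArg (fun τ => rc q τ (-c₀)) h
    simp only [rc_add, add_neg_cancel, rc_zero] at this
    rwa [← sub_eq_add_neg] at this
  · intro h
    have := congrArg (fun τ => rc q τ c₀) h
    simpa only [rc_add, sub_add_cancel] using this

/-- A combinatorial type `τ = [σ]` in `𝒞_q` with `des τ = d` and `sym τ = s` has
exactly `((k-1)/s) · C(q+k-d-1, q-1)` realizations under `m_k` for every integer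
`k > d`, `k ≥ 2` (stated as: `s` times the number of realizations equals
`(k-1) · C(q+k-d-1, q-1)`). -/
theorem type_realization_count (q d s k : ℕ) [NeZero q] (hq : 2 ≤ q)
    (σ : Equiv.Perm (ZMod q)) (hσ : IsQCycle q σ) (hd : desNum q σ = d)
    (hs : symOrder q σ = s) (hk2 : 2 ≤ k) (hkd : d < k) :
    {x : ZMod q → ℝ | ∃ j : ℕ,
      MkRealization q k (rotPerm q ^ j * σ * (rotPerm q ^ j)⁻¹) x}.ncard * s
      = (k - 1) * Nat.choose (q + k - d - 1) (q - 1) := by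
  obtain ⟨n, rfl⟩ : ∃ n, q = n + 1 := ⟨q - 1, by omega⟩
  have hcnt : ∀ c, {x | MkRealization (n + 1) k (rc (n + 1) σ c) x}.ncard =
      (k + n - d + if rep (n + 1) (rc (n + 1) σ c 1) < rep (n + 1) (rc (n + 1) σ c 0)
        then 1 else 0).choose (n + 1) := by
    intro c
    have hdc : desNum (n + 1) (rc (n + 1) σ c) = d := by rw [des_rc, hd]
    rw [← hdc]
    exact mk_count n k (by omega) hk2 _ (cyc_rc _ σ hσ c) (by omega)
  have hfin : ∀ c, {x | MkRealization (n + 1) k (rc (n + 1) σ c) x}.Finite := by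
    intro c
    apply Set.finite_of_ncard_pos
    rw [hcnt]
    apply Nat.choose_pos
    omega
  have hset : {x : ZMod (n + 1) → ℝ | ∃ j : ℕ,
      MkRealization (n + 1) k (rotPerm (n + 1) ^ j * σ * (rotPerm (n + 1) ^ j)⁻¹) x} =
      ⋃ c, {x | MkRealization (n + 1) k (rc (n + 1) σ c) x} := by
    ext x
    simp only [conj_eq, Set.mem_ofPred_eq, Set.mem_iUnion]
    constructor
    · rintro ⟨j, hj⟩; exact ⟨_, hj⟩
    · rintro ⟨c, hc⟩
      exact ⟨c.val, by rwa [ZMod.natCast_zmod_val]⟩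
  rw [hset]
  have hfinU : (⋃ c, {x | MkRealization (n + 1) k (rc (n + 1) σ c) x}).Finite :=
    Set.finite_iUnion hfin
  -- double counting
  have hdc := Finset.sum_card_bipartiteAbove_eq_sum_card_bipartiteBelow
    (s := hfinU.toFinset) (t := (Finset.univ : Finset (ZMod (n + 1))))
    (fun x c => MkRealization (n + 1) k (rc (n + 1) σ c) x)
  have hleft : ∀ x ∈ hfinU.toFinset, (Finset.bipartiteAbove
      (fun x c => MkRealization (n + 1) k (rc (n + 1) σ c) x)
      (Finset.univ : Finset (ZMod (n + 1))) x).card = s := by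
    intro x hx
    rw [Set.Finite.mem_toFinset, Set.mem_iUnion] at hx
    obtain ⟨c₀, hc₀⟩ := hx
    rw [← hs, ← fiber_card (n + 1) σ c₀]
    congr 1
    ext c
    simp only [Finset.mem_bipartiteAbove, Finset.mem_filter, Finset.mem_univ, true_and]
    constructor
    · intro h; exact mk_unique _ _ _ _ _ h hc₀
    · intro h; rw [h]; exact hc₀
  have hright : ∀ c ∈ (Finset.univ : Finset (ZMod (n + 1))), (Finset.bipartiteBelow
      (fun x c => MkRealization (n + 1) k (rc (n + 1) σ c) x) hfinU.toFinset c).card =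
      (k + n - d).choose (n + 1) +
        (if rep (n + 1) (rc (n + 1) σ c 1) < rep (n + 1) (rc (n + 1) σ c 0)
        then 1 else 0) * (k + n - d).choose n := by
    intro c _
    have h1 : (Finset.bipartiteBelow
      (fun x c => MkRealization (n + 1) k (rc (n + 1) σ c) x) hfinU.toFinset c) =
      (hfin c).toFinset := by
      ext x
      simp only [Finset.mem_bipartiteBelow, Set.Finite.mem_toFinset, Set.mem_iUnion,
        Set.mem_ofPred_eq]
      exact ⟨fun h => h.2, fun h => ⟨⟨c, h⟩, h⟩⟩
    rw [h1, ← Set.ncard_eq_toFinset_card _ (hfin c), hcnt]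
    split_ifs
    · rw [Nat.choose_succ_succ, one_mul, add_comm]
    · simp
  rw [Finset.sum_congr rfl hleft, Finset.sum_congr rfl hright, Finset.sum_const, smul_eq_mul,
    ← Set.ncard_eq_toFinset_card _ hfinU, Finset.sum_add_distrib, ← Finset.sum_mul,
    ← Finset.card_filter, Finset.sum_const, Finset.card_univ, ZMod.card, smul_eq_mul] at hdc
  rw [hdc]
  have hm := marked_count (n + 1) hq σ hσ
  rw [hd] at hm
  set A := (Finset.univ.filter fun c : ZMod (n + 1) =>
    rep (n + 1) (rc (n + 1) σ c 1) < rep (n + 1) (rc (n + 1) σ c 0)).card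
  have hch := Nat.choose_succ_right_eq (k + n - d) n
  rw [show n + 1 + k - d - 1 = k + n - d by omega, Nat.add_sub_cancel]
  rw [mul_comm (n + 1), hch, show k + n - d - n = k - d by omega, mul_comm _ (k - d), ← add_mul]
  congr 1
  omega
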